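/- arXiv:1105.6351 — 10 statements merged into one kernel-verified Lean document; each statement's English description precedes it below -/
import Mathlib

section
/- For every ε ≥ 0, every integer p ≥ 1 and every t ≥ 0, one has R_Φ(ε) ≤ max{λ_max(D_p − t·√D_p·Ψ_p·√D_p), 0} + t·(ε + √T_p)² + σ_{p+1}, where √D_p is the positive square root of D_p (so that √D_p·Ψ_p·√D_p is the p×p matrix with entries ⟨Φe_j, Φe_k⟩_{ℝⁿ} for j,k ≤ p). -/
open scoped RealInnerProductSpace Matrix

/-- The squared `ℓ²` norm is the sum of the squared coordinates. -/
lemma lp_two_hasSum_sq (α : lp (fun _ : ℕ => ℝ) 2) :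
    HasSum (fun k => α k ^ 2) (‖α‖ ^ 2) := by
  have h := lp.hasSum_norm (p := 2) (by norm_num) α
  simpa using h

/-- The head of `α` up to index `p`. -/
noncomputable def lpHead (p : ℕ) (α : lp (fun _ : ℕ => ℝ) 2) : lp (fun _ : ℕ => ℝ) 2 :=
  ∑ j ∈ Finset.range p, lp.single 2 j (α j)

lemma norm_sub_lpHead_le (p : ℕ) (α : lp (fun _ : ℕ => ℝ) 2) : ‖α - lpHead p α‖ ≤ ‖α‖ := by
  have h := lp.norm_sub_norm_compl_sub_single (p := 2) (by norm_num) α (Finset.range p)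
  have h2 : ‖α - lpHead p α‖ ^ 2 ≤ ‖α‖ ^ 2 := by
    have h0 : 0 ≤ ∑ i ∈ Finset.range p, α i ^ 2 := Finset.sum_nonneg fun i _ => sq_nonneg _
    simp at h
    unfold lpHead
    linarith
  exact (sq_le_sq₀ (norm_nonneg _) (norm_nonneg _)).1 h2

lemma sub_lpHead_apply_eq_zero (p : ℕ) (α : lp (fun _ : ℕ => ℝ) 2) {k : ℕ} (hk : k < p) :
    (α - lpHead p α) k = 0 := by
  rw [lp.coeFn_sub, Pi.sub_apply, lpHead, lp.coeFn_sum, Finset.sum_apply]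
  simp [Pi.single_apply, hk]

/-- The image of the head is a finite combination of the images of the basis vectors. -/
lemma map_lpHead {E : Type*} [NormedAddCommGroup E] [NormedSpace ℝ E]
    (Φ : lp (fun _ : ℕ => ℝ) 2 →L[ℝ] E) (p : ℕ) (α : lp (fun _ : ℕ => ℝ) 2) :
    Φ (lpHead p α) = ∑ j : Fin p, α j • Φ (lp.single 2 (j : ℕ) 1) := by
  rw [lpHead, map_sum, Finset.sum_range]
  refine Finset.sum_congr rfl fun j _ => ?_
  rw [← map_smul, ← lp.single_smul]
  simp

/-- The quadratic form of a Gram matrix is a squared norm. -/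
lemma dotProduct_gram_mulVec {E ι : Type*} [NormedAddCommGroup E] [InnerProductSpace ℝ E]
    [Fintype ι] (v : ι → E) (A : Matrix ι ι ℝ) (hA : ∀ j k, A j k = ⟪v j, v k⟫) (x : ι → ℝ) :
    x ⬝ᵥ A.mulVec x = ‖∑ j, x j • v j‖ ^ 2 := by
  rw [← real_inner_self_eq_norm_sq, sum_inner]
  simp only [dotProduct, Matrix.mulVec, inner_sum, inner_smul_left, inner_smul_right, hA]
  refine Finset.sum_congr rfl fun j _ => ?_
  simp only [Finset.mul_sum]
  refine Finset.sum_congr rfl fun k _ => ?_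
  simp
  ring

lemma bddAbove_rayleigh {ι : Type*} [Fintype ι] (M : Matrix ι ι ℝ) :
    BddAbove {r : ℝ | ∃ x : ι → ℝ, (∑ i, x i ^ 2) = 1 ∧ r = x ⬝ᵥ M.mulVec x} := by
  refine ⟨∑ i, ∑ j, |M i j|, ?_⟩
  rintro r ⟨x, hx, rfl⟩
  have hx1 : ∀ i, |x i| ≤ 1 := fun i => by
    rw [← sq_le_one_iff_abs_le_one, ← hx]
    exact Finset.single_le_sum (f := fun i => x i ^ 2) (fun i _ => sq_nonneg _)
      (Finset.mem_univ i)
  simp only [dotProduct, Matrix.mulVec, Finset.mul_sum]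
  refine Finset.sum_le_sum fun i _ => Finset.sum_le_sum fun j _ => ?_
  calc x i * (M i j * x j) ≤ |x i * (M i j * x j)| := le_abs_self _
    _ = |x i| * (|M i j| * |x j|) := by rw [abs_mul, abs_mul]
    _ ≤ 1 * (|M i j| * 1) := by gcongr <;> exact hx1 _
    _ = |M i j| := by ring

/-- On the unit ball a quadratic form is bounded by the positive part of its largest
Rayleigh quotient. -/
lemma dotProduct_mulVec_le_max_rayleigh {ι : Type*} [Fintype ι] (M : Matrix ι ι ℝ) (x : ι → ℝ)
    (hx : ∑ i, x i ^ 2 ≤ 1) :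
    x ⬝ᵥ M.mulVec x ≤
      max (sSup {r : ℝ | ∃ x : ι → ℝ, (∑ i, x i ^ 2) = 1 ∧ r = x ⬝ᵥ M.mulVec x}) 0 := by
  set S := {r : ℝ | ∃ x : ι → ℝ, (∑ i, x i ^ 2) = 1 ∧ r = x ⬝ᵥ M.mulVec x} with hS
  have hs0 : 0 ≤ ∑ i, x i ^ 2 := Finset.sum_nonneg fun i _ => sq_nonneg _
  rcases hs0.eq_or_lt with hs | hs
  · have hx0 : x = 0 := by
      funext i
      simpa using (Finset.sum_eq_zero_iff_of_nonneg fun i _ => sq_nonneg (x i)).1 hs.symm i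
        (Finset.mem_univ i)
    simp [hx0]
  · set s := ∑ i, x i ^ 2
    have hsq : (√s) ^ 2 = s := Real.sq_sqrt hs0
    have hsp : 0 < √s := Real.sqrt_pos.2 hs
    have hmem : (s⁻¹ * (x ⬝ᵥ M.mulVec x)) ∈ S := by
      refine ⟨(√s)⁻¹ • x, ?_, ?_⟩
      · simp only [Pi.smul_apply, smul_eq_mul, mul_pow, ← Finset.mul_sum, inv_pow, hsq]
        exact inv_mul_cancel₀ hs.ne'
      · rw [Matrix.mulVec_smul, dotProduct_smul, smul_dotProduct, smul_eq_mul, smul_eq_mul,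
          ← mul_assoc, ← mul_inv, ← sq, hsq]
    have h1 : s⁻¹ * (x ⬝ᵥ M.mulVec x) ≤ max (sSup S) 0 :=
      (le_csSup (bddAbove_rayleigh M) hmem).trans (le_max_left _ _)
    calc x ⬝ᵥ M.mulVec x = s * (s⁻¹ * (x ⬝ᵥ M.mulVec x)) := by field_simp
      _ ≤ s * max (sSup S) 0 := by gcongr
      _ ≤ 1 * max (sSup S) 0 := by gcongr
      _ = _ := one_mul _

/-- A nonincreasingly weighted sum is bounded by its head plus the next weight. -/
lemma tsum_weighted_sq_le (σ : ℕ → ℝ) (hσpos : ∀ k, 0 < σ k) (hσ : Antitone σ)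
    (α : lp (fun _ : ℕ => ℝ) 2) (hα : ‖α‖ ≤ 1) (p : ℕ) :
    ∑' k, σ k * α k ^ 2 ≤ ∑ j : Fin p, σ j * α j ^ 2 + σ p := by
  have hs := lp_two_hasSum_sq α
  have hsum : Summable fun k => σ k * α k ^ 2 :=
    Summable.of_nonneg_of_le (fun k => mul_nonneg (hσpos k).le (sq_nonneg _))
      (fun k => mul_le_mul_of_nonneg_right (hσ (Nat.zero_le k)) (sq_nonneg _))
      (hs.summable.mul_left (σ 0))
  have htail : ∑' k, α (k + p) ^ 2 ≤ 1 := by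
    have h := hs.summable.sum_add_tsum_nat_add p
    rw [hs.tsum_eq] at h
    have h0 : 0 ≤ ∑ i ∈ Finset.range p, α i ^ 2 := Finset.sum_nonneg fun i _ => sq_nonneg _
    have h1 : ‖α‖ ^ 2 ≤ 1 := pow_le_one₀ (norm_nonneg _) hα
    linarith
  rw [← hsum.sum_add_tsum_nat_add p, Finset.sum_range]
  gcongr
  calc ∑' k, σ (k + p) * α (k + p) ^ 2 ≤ ∑' k, σ p * α (k + p) ^ 2 :=
        Summable.tsum_le_tsum
          (fun k => mul_le_mul_of_nonneg_right (hσ (Nat.le_add_left p k)) (sq_nonneg _))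
          ((summable_nat_add_iff p).2 hsum)
          (((summable_nat_add_iff p).2 hs.summable).mul_left _)
    _ = σ p * ∑' k, α (k + p) ^ 2 := tsum_mul_left
    _ ≤ σ p * 1 := mul_le_mul_of_nonneg_left htail (hσpos p).le
    _ = σ p := mul_one _

/-- A vector of the unit ball supported beyond `p` has image of norm at most `√T_p`. -/
lemma norm_map_le_sqrt_sSup {E : Type*} [NormedAddCommGroup E] [NormedSpace ℝ E]
    (Φ : lp (fun _ : ℕ => ℝ) 2 →L[ℝ] E) (p : ℕ) (γ : lp (fun _ : ℕ => ℝ) 2)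
    (hγ : ‖γ‖ ≤ 1) (hγp : ∀ k < p, γ k = 0) :
    ‖Φ γ‖ ≤ √(sSup {r : ℝ | ∃ γ : lp (fun _ : ℕ => ℝ) 2,
      ‖γ‖ ≤ 1 ∧ (∀ k : ℕ, k < p → γ k = 0) ∧ r = ‖Φ γ‖ ^ 2}) := by
  refine Real.le_sqrt_of_sq_le (le_csSup ⟨‖Φ‖ ^ 2, ?_⟩ ⟨γ, hγ, hγp, rfl⟩)
  rintro r ⟨δ, hδ, -, rfl⟩
  gcongr
  exact Φ.unit_le_opNorm δ hδ

/-- first bound of the main theorem.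
`σ` is the nonincreasing sequence of positive weights (0-indexed: `σ k` is the paper's
`σ_{k+1}`), `Φ : ℓ²(ℕ) → ℝⁿ` is a continuous linear operator, and
`R ε = sup { ∑ σ_k α_k² : ‖α‖_{ℓ²} ≤ 1, ‖Φα‖² ≤ ε² }`.
`A` is the `p × p` matrix `√D_p Ψ_p √D_p`, with entries `⟨Φ e_j, Φ e_k⟩`, `D` is
`diag(σ₁, …, σ_p)`, `T = T_p`, and `lmax` is the largest Rayleigh quotient of the symmetric
matrix `D - t • A` on the unit sphere, i.e. its largest eigenvalue `λ_max(D - t √D Ψ √D)`.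
Conclusion: `R ε ≤ max{λ_max(D - t √D Ψ √D), 0} + t (ε + √T_p)² + σ_{p+1}`. -/
theorem stmt0
    (σ : ℕ → ℝ) (hσpos : ∀ k, 0 < σ k) (hσmono : ∀ k, σ (k + 1) ≤ σ k)
    (n : ℕ) (hn : 1 ≤ n)
    (Φ : lp (fun _ : ℕ => ℝ) 2 →L[ℝ] EuclideanSpace ℝ (Fin n))
    (R : ℝ → ℝ)
    (hR : ∀ ε : ℝ, R ε = sSup {r : ℝ | ∃ α : lp (fun _ : ℕ => ℝ) 2,
      ‖α‖ ≤ 1 ∧ ‖Φ α‖ ^ 2 ≤ ε ^ 2 ∧ r = ∑' k : ℕ, σ k * (α k) ^ 2})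
    (p : ℕ) (hp : 1 ≤ p) (t : ℝ) (ht : 0 ≤ t) (ε : ℝ) (hε : 0 ≤ ε)
    (A : Matrix (Fin p) (Fin p) ℝ)
    (hA : ∀ j k : Fin p,
      A j k = ⟪Φ (lp.single 2 (j : ℕ) 1), Φ (lp.single 2 (k : ℕ) 1)⟫)
    (D : Matrix (Fin p) (Fin p) ℝ)
    (hD : D = Matrix.diagonal (fun j : Fin p => σ (j : ℕ)))
    (T : ℝ)
    (hT : T = sSup {r : ℝ | ∃ γ : lp (fun _ : ℕ => ℝ) 2,
      ‖γ‖ ≤ 1 ∧ (∀ k : ℕ, k < p → γ k = 0) ∧ r = ‖Φ γ‖ ^ 2})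
    (lmax : ℝ)
    (hlmax : lmax = sSup {r : ℝ | ∃ x : Fin p → ℝ,
      (∑ i, x i ^ 2) = 1 ∧ r = x ⬝ᵥ (D - t • A).mulVec x}) :
    R ε ≤ max lmax 0 + t * (ε + Real.sqrt T) ^ 2 + σ p := by
  rw [hR]
  refine csSup_le ⟨_, 0, by simp, by simpa using sq_nonneg ε, rfl⟩ ?_
  rintro r ⟨α, hα, hΦα, rfl⟩
  have hbound := tsum_weighted_sq_le σ hσpos (antitone_nat_of_succ_le hσmono) α hα p
  have hΦα' : ‖Φ α‖ ≤ ε := (sq_le_sq₀ (norm_nonneg _) hε).1 hΦα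
  have hγ : ‖Φ (α - lpHead p α)‖ ≤ √T := hT ▸ norm_map_le_sqrt_sSup Φ p _
    ((norm_sub_lpHead_le p α).trans hα) fun k hk => sub_lpHead_apply_eq_zero p α hk
  have hβ : ‖Φ (lpHead p α)‖ ≤ ε + √T := by
    have h : Φ (lpHead p α) = Φ α - Φ (α - lpHead p α) := by rw [map_sub]; abel
    rw [h]
    exact (norm_sub_le _ _).trans (add_le_add hΦα' hγ)
  have hx : ∑ i : Fin p, α i ^ 2 ≤ 1 := by
    rw [← Finset.sum_range (fun i => α i ^ 2)]
    exact (sum_le_hasSum _ (fun i _ => sq_nonneg _) (lp_two_hasSum_sq α)).trans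
      (pow_le_one₀ (norm_nonneg _) hα)
  have hray := dotProduct_mulVec_le_max_rayleigh (D - t • A) (fun i : Fin p => α i) hx
  rw [← hlmax, Matrix.sub_mulVec, dotProduct_sub, Matrix.smul_mulVec, dotProduct_smul,
    dotProduct_gram_mulVec _ A hA, ← map_lpHead Φ p α, smul_eq_mul, hD] at hray
  have hdiag : (fun i : Fin p => α i) ⬝ᵥ
      (Matrix.diagonal fun j : Fin p => σ j).mulVec (fun i : Fin p => α i) =
        ∑ j : Fin p, σ j * α j ^ 2 := by
    simp only [dotProduct, Matrix.mulVec_diagonal]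
    exact Finset.sum_congr rfl fun j _ => by ring
  rw [hdiag] at hray
  have hsq : t * ‖Φ (lpHead p α)‖ ^ 2 ≤ t * (ε + √T) ^ 2 := by gcongr
  linarith
end

section
/- If λ_min(Ψ_p) > 0 for some integer p ≥ 1, then for every ε ≥ 0 one has R_Φ(ε) ≤ (1 − σ_{p+1}/σ₁) · (ε + √T_p)² / λ_min(Ψ_p) + σ_{p+1}. -/
open scoped RealInnerProductSpace Matrix

/-- The quadratic form of a rescaled Gram matrix is a squared norm. -/
theorem dotProduct_mulVec_rescaled_gram {ι E : Type*} [Fintype ι] [NormedAddCommGroup E]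
    [InnerProductSpace ℝ E] (v : ι → E) (s : ι → ℝ) (hs : ∀ i, 0 < s i) (M : Matrix ι ι ℝ)
    (hM : ∀ j k, M j k = ⟪v j, v k⟫ / √(s j * s k)) (x : ι → ℝ) :
    x ⬝ᵥ M.mulVec x = ‖∑ i, (x i / √(s i)) • v i‖ ^ 2 := by
  rw [← real_inner_self_eq_norm_sq, sum_inner]
  simp only [dotProduct, Matrix.mulVec, inner_sum, real_inner_smul_left, real_inner_smul_right,
    Finset.mul_sum, hM]
  refine Finset.sum_congr rfl fun i _ => Finset.sum_congr rfl fun j _ => ?_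
  rw [Real.sqrt_mul (hs i).le]
  have h1 := (Real.sqrt_pos.2 (hs i)).ne'
  have h2 := (Real.sqrt_pos.2 (hs j)).ne'
  field_simp

/-- A nonnegative quadratic form is bounded below by its infimum over the unit sphere times the
squared norm. -/
theorem sInf_rayleigh_mul_le {ι : Type*} [Fintype ι] (M : Matrix ι ι ℝ)
    (hM : ∀ x : ι → ℝ, 0 ≤ x ⬝ᵥ M.mulVec x) (x : ι → ℝ) :
    sInf {r : ℝ | ∃ x : ι → ℝ, (∑ i, x i ^ 2) = 1 ∧ r = x ⬝ᵥ M.mulVec x} * ∑ i, x i ^ 2 ≤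
      x ⬝ᵥ M.mulVec x := by
  have h0 : 0 ≤ ∑ i, x i ^ 2 := Finset.sum_nonneg fun i _ => sq_nonneg _
  rcases h0.eq_or_lt with h | h
  · rw [← h, mul_zero]
    exact hM x
  · set c := √(∑ i, x i ^ 2) with hc
    have hcpos : 0 < c := Real.sqrt_pos.2 h
    have hcsq : c ^ 2 = ∑ i, x i ^ 2 := Real.sq_sqrt h0
    have hle : sInf {r : ℝ | ∃ x : ι → ℝ, (∑ i, x i ^ 2) = 1 ∧ r = x ⬝ᵥ M.mulVec x} ≤
        (c⁻¹ • x) ⬝ᵥ M.mulVec (c⁻¹ • x) := by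
      refine csInf_le ⟨0, ?_⟩ ⟨c⁻¹ • x, ?_, rfl⟩
      · rintro _ ⟨y, -, rfl⟩
        exact hM y
      · simp only [Pi.smul_apply, smul_eq_mul, mul_pow, ← Finset.mul_sum, ← hcsq]
        field_simp
    rw [Matrix.mulVec_smul, smul_dotProduct, dotProduct_smul, smul_eq_mul, smul_eq_mul] at hle
    rw [← hcsq]
    calc _ ≤ c⁻¹ * (c⁻¹ * x ⬝ᵥ M.mulVec x) * c ^ 2 := by gcongr
      _ = x ⬝ᵥ M.mulVec x := by field_simp

/-- Head-tail estimate for a weighted sum of squares with nonincreasing weights. -/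
theorem tsum_mul_sq_le_head_add_tail (σ : ℕ → ℝ) (hσpos : ∀ k, 0 < σ k) (hσ : Antitone σ)
    (a : ℕ → ℝ) (ha : Summable fun k => a k ^ 2) (ha1 : ∑' k, a k ^ 2 ≤ 1) (p : ℕ) :
    ∑' k, σ k * a k ^ 2 ≤
      (1 - σ p / σ 0) * ∑ k ∈ Finset.range p, σ k * a k ^ 2 + σ p := by
  have hs : Summable fun k => σ k * a k ^ 2 :=
    Summable.of_nonneg_of_le (fun k => mul_nonneg (hσpos k).le (sq_nonneg _))
      (fun k => mul_le_mul_of_nonneg_right (hσ (Nat.zero_le k)) (sq_nonneg _)) (ha.mul_left (σ 0))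
  have htail : ∑' k, σ (k + p) * a (k + p) ^ 2 ≤ σ p * ∑' k, a (k + p) ^ 2 := by
    rw [← tsum_mul_left]
    exact ((summable_nat_add_iff p).2 hs).tsum_le_tsum
      (fun k => mul_le_mul_of_nonneg_right (hσ (Nat.le_add_left p k)) (sq_nonneg _))
      (((summable_nat_add_iff p).2 ha).mul_left (σ p))
  have hhead : ∑ k ∈ Finset.range p, σ k * a k ^ 2 ≤ σ 0 * ∑ k ∈ Finset.range p, a k ^ 2 := by
    rw [Finset.mul_sum]
    gcongr with k _
    exact hσ (Nat.zero_le k)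
  have hhead' : σ p / σ 0 * ∑ k ∈ Finset.range p, σ k * a k ^ 2 ≤
      σ p * ∑ k ∈ Finset.range p, a k ^ 2 := by
    have h0 := hσpos 0
    calc _ ≤ σ p / σ 0 * (σ 0 * ∑ k ∈ Finset.range p, a k ^ 2) :=
          mul_le_mul_of_nonneg_left hhead (div_pos (hσpos p) h0).le
      _ = _ := by field_simp
  rw [← hs.sum_add_tsum_nat_add p]
  rw [← ha.sum_add_tsum_nat_add p] at ha1
  have := mul_le_mul_of_nonneg_left ha1 (hσpos p).le
  linarith

/-- A truncation estimate: the image of the leading coordinates of `α` is controlled by the image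
of `α` and the largest image of a unit-ball vector with vanishing leading coordinates. -/
theorem norm_map_sum_single_le {E : Type*} [NormedAddCommGroup E] [NormedSpace ℝ E]
    (Φ : lp (fun _ : ℕ => ℝ) 2 →L[ℝ] E) (p : ℕ) (α : lp (fun _ : ℕ => ℝ) 2) (hα : ‖α‖ ≤ 1) :
    ‖Φ (∑ k ∈ Finset.range p, lp.single 2 k (α k))‖ ≤
      ‖Φ α‖ + √(sSup {r : ℝ | ∃ γ : lp (fun _ : ℕ => ℝ) 2,
        ‖γ‖ ≤ 1 ∧ (∀ k : ℕ, k < p → γ k = 0) ∧ r = ‖Φ γ‖ ^ 2}) := by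
  set β := ∑ k ∈ Finset.range p, lp.single (E := fun _ : ℕ => ℝ) 2 k (α k) with hβ
  have hγ1 : ‖α - β‖ ≤ 1 := by
    have h := lp.norm_compl_sum_single (E := fun _ : ℕ => ℝ) (p := 2) (by norm_num) α
      (Finset.range p)
    have h2 : (0 : ℝ) ≤ ∑ i ∈ Finset.range p, ‖α i‖ ^ (2 : ℝ) :=
      Finset.sum_nonneg fun i _ => by positivity
    simp only [ENNReal.toReal_ofNat, Real.rpow_two] at h h2
    rw [← hβ] at h
    exact ((sq_le_sq₀ (norm_nonneg _) (norm_nonneg _)).1 (by linarith)).trans hα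
  have hγ0 : ∀ k : ℕ, k < p → (α - β) k = 0 := by
    intro k hk
    simp only [hβ, lp.coeFn_sub, Pi.sub_apply, lp.coeFn_sum, lp.coeFn_single, Finset.sum_apply,
      Finset.sum_pi_single, Finset.mem_range, if_pos hk, sub_self]
  have hle : ‖Φ (α - β)‖ ≤ √(sSup {r : ℝ | ∃ γ : lp (fun _ : ℕ => ℝ) 2,
      ‖γ‖ ≤ 1 ∧ (∀ k : ℕ, k < p → γ k = 0) ∧ r = ‖Φ γ‖ ^ 2}) := by
    refine Real.le_sqrt_of_sq_le (le_csSup ⟨‖Φ‖ ^ 2, ?_⟩ ⟨α - β, hγ1, hγ0, rfl⟩)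
    rintro _ ⟨γ, hγ, -, rfl⟩
    have := Φ.le_of_opNorm_le_of_le le_rfl hγ
    rw [mul_one] at this
    gcongr
  calc ‖Φ β‖ = ‖Φ α - Φ (α - β)‖ := by rw [← map_sub, sub_sub_cancel]
    _ ≤ ‖Φ α‖ + ‖Φ (α - β)‖ := norm_sub_le _ _
    _ ≤ _ := by gcongr

/-- second bound of the main theorem.
`σ` is the nonincreasing sequence of positive weights (0-indexed: `σ k` is the paper's
`σ_{k+1}`), `Φ : ℓ²(ℕ) → ℝⁿ` is a continuous linear operator, and
`R ε = sup { ∑ σ_k α_k² : ‖α‖_{ℓ²} ≤ 1, ‖Φα‖² ≤ ε² }`.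
`Ψ` is the `p × p` matrix with entries `⟨Φ e_j, Φ e_k⟩ / √(σ_j σ_k)`, `T = T_p`, and
`lmin` is the smallest Rayleigh quotient of the symmetric matrix `Ψ` on the unit sphere,
i.e. its smallest eigenvalue `λ_min(Ψ_p)`.
Conclusion: if `λ_min(Ψ_p) > 0` then
`R ε ≤ (1 - σ_{p+1}/σ₁) (ε + √T_p)² / λ_min(Ψ_p) + σ_{p+1}`. -/
theorem stmt1
    (σ : ℕ → ℝ) (hσpos : ∀ k, 0 < σ k) (hσmono : ∀ k, σ (k + 1) ≤ σ k)
    (n : ℕ) (hn : 1 ≤ n)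
    (Φ : lp (fun _ : ℕ => ℝ) 2 →L[ℝ] EuclideanSpace ℝ (Fin n))
    (R : ℝ → ℝ)
    (hR : ∀ ε : ℝ, R ε = sSup {r : ℝ | ∃ α : lp (fun _ : ℕ => ℝ) 2,
      ‖α‖ ≤ 1 ∧ ‖Φ α‖ ^ 2 ≤ ε ^ 2 ∧ r = ∑' k : ℕ, σ k * (α k) ^ 2})
    (p : ℕ) (hp : 1 ≤ p) (ε : ℝ) (hε : 0 ≤ ε)
    (Ψ : Matrix (Fin p) (Fin p) ℝ)
    (hΨ : ∀ j k : Fin p,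
      Ψ j k = ⟪Φ (lp.single 2 (j : ℕ) 1), Φ (lp.single 2 (k : ℕ) 1)⟫ /
        Real.sqrt (σ (j : ℕ) * σ (k : ℕ)))
    (T : ℝ)
    (hT : T = sSup {r : ℝ | ∃ γ : lp (fun _ : ℕ => ℝ) 2,
      ‖γ‖ ≤ 1 ∧ (∀ k : ℕ, k < p → γ k = 0) ∧ r = ‖Φ γ‖ ^ 2})
    (lmin : ℝ)
    (hlmin : lmin = sInf {r : ℝ | ∃ x : Fin p → ℝ,
      (∑ i, x i ^ 2) = 1 ∧ r = x ⬝ᵥ Ψ.mulVec x})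
    (hpos : 0 < lmin) :
    R ε ≤ (1 - σ p / σ 0) * (ε + Real.sqrt T) ^ 2 / lmin + σ p := by
  have hσ : Antitone σ := antitone_nat_of_succ_le hσmono
  have hquad := dotProduct_mulVec_rescaled_gram
    (fun j : Fin p => Φ (lp.single 2 (j : ℕ) 1)) (fun j => σ j) (fun j => hσpos j) Ψ hΨ
  rw [hR]
  refine csSup_le ⟨_, 0, by simp, by simp [sq_nonneg], rfl⟩ ?_
  rintro _ ⟨α, hα, hΦα, rfl⟩
  have hasum : HasSum (fun k => α k ^ 2) (‖α‖ ^ 2) := by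
    have h := lp.hasSum_norm (E := fun _ : ℕ => ℝ) (p := 2) (by norm_num) α
    simpa using h
  have hε' : ‖Φ α‖ ≤ ε := (sq_le_sq₀ (norm_nonneg _) hε).1 hΦα
  set S := ∑ k ∈ Finset.range p, σ k * α k ^ 2 with hS
  have hmain : lmin * S ≤ (ε + √T) ^ 2 := by
    have h := sInf_rayleigh_mul_le Ψ (fun x => by rw [hquad]; positivity)
      (fun i => √(σ i) * α i)
    have hsum : ∑ i : Fin p, (√(σ i) * α i) ^ 2 = S := by
      rw [hS, ← Fin.sum_univ_eq_sum_range (fun k => σ k * α k ^ 2)]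
      exact Finset.sum_congr rfl fun i _ => by rw [mul_pow, Real.sq_sqrt (hσpos i).le]
    have hvec : ∑ i : Fin p, (√(σ i) * α i / √(σ i)) • Φ (lp.single 2 (i : ℕ) 1) =
        Φ (∑ k ∈ Finset.range p, lp.single 2 k (α k)) := by
      rw [← Fin.sum_univ_eq_sum_range (fun k => lp.single (E := fun _ : ℕ => ℝ) 2 k (α k)),
        map_sum]
      refine Finset.sum_congr rfl fun i _ => ?_
      rw [mul_div_cancel_left₀ _ (Real.sqrt_pos.2 (hσpos i)).ne', ← map_smul, ← lp.single_smul,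
        smul_eq_mul, mul_one]
    rw [hquad, hsum, hvec, ← hlmin] at h
    refine h.trans ?_
    have hb := norm_map_sum_single_le Φ p α hα
    rw [← hT] at hb
    gcongr
    linarith
  have hcoef : 0 ≤ 1 - σ p / σ 0 :=
    sub_nonneg.2 ((div_le_one (hσpos 0)).2 (hσ (Nat.zero_le p)))
  have hbound := tsum_mul_sq_le_head_add_tail σ hσpos hσ (fun k => α k) hasum.summable
    (hasum.tsum_eq.trans_le (pow_le_one₀ (norm_nonneg _) hα)) p
  refine hbound.trans ?_
  rw [mul_div_assoc]
  gcongr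
  rw [le_div_iff₀ hpos, mul_comm]
  exact hmain
end

section
/- For every integer n ≥ 1, the infimum over all surjective continuous linear operators Φ : ℓ²(ℕ) → ℝⁿ of the quantity sup{Σ_{k≥1} σ_k α_k² : α ∈ ℓ², ‖α‖_{ℓ²} ≤ 1, Φα = 0} is equal to σ_{n+1}; moreover this infimum is attained, for instance by the coordinate truncation operator α ↦ (α₁, …, α_n). -/
namespace RealEllTwo

theorem hasSum_sq (α : lp (fun _ : ℕ => ℝ) 2) : HasSum (fun k => α k ^ 2) (‖α‖ ^ 2) := by
  simpa using lp.hasSum_norm (p := 2) (by norm_num) α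

theorem summable_weighted_sq {σ : ℕ → ℝ} (hσpos : ∀ k, 0 < σ k) (hσ : Antitone σ)
    (α : lp (fun _ : ℕ => ℝ) 2) : Summable fun k => σ k * α k ^ 2 :=
  Summable.of_nonneg_of_le (fun k => mul_nonneg (hσpos k).le (sq_nonneg _))
    (fun k => mul_le_mul_of_nonneg_right (hσ (Nat.zero_le k)) (sq_nonneg _))
    ((hasSum_sq α).summable.mul_left (σ 0))

theorem tsum_weighted_sq_le {σ : ℕ → ℝ} (hσpos : ∀ k, 0 < σ k) (hσ : Antitone σ) {n : ℕ}
    {α : lp (fun _ : ℕ => ℝ) 2} (hα : ‖α‖ ≤ 1) (h0 : ∀ k < n, α k = 0) :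
    ∑' k, σ k * α k ^ 2 ≤ σ n := by
  have hle : ∑' k, σ k * α k ^ 2 ≤ ∑' k, σ n * α k ^ 2 := by
    refine (summable_weighted_sq hσpos hσ α).tsum_le_tsum (fun k => ?_)
      ((hasSum_sq α).summable.mul_left (σ n))
    rcases lt_or_ge k n with hk | hk
    · simp [h0 k hk]
    · exact mul_le_mul_of_nonneg_right (hσ hk) (sq_nonneg _)
  rw [((hasSum_sq α).mul_left (σ n)).tsum_eq] at hle
  exact hle.trans (mul_le_of_le_one_right (hσpos n).le (pow_le_one₀ (norm_nonneg _) hα))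

theorem le_tsum_weighted_sq {σ : ℕ → ℝ} (hσpos : ∀ k, 0 < σ k) (hσ : Antitone σ) {n : ℕ}
    {α : lp (fun _ : ℕ => ℝ) 2} (hα : ‖α‖ = 1) (h0 : ∀ k, n < k → α k = 0) :
    σ n ≤ ∑' k, σ k * α k ^ 2 := by
  have hle : ∑' k, σ n * α k ^ 2 ≤ ∑' k, σ k * α k ^ 2 := by
    refine ((hasSum_sq α).summable.mul_left (σ n)).tsum_le_tsum (fun k => ?_)
      (summable_weighted_sq hσpos hσ α)
    rcases lt_or_ge n k with hk | hk
    · simp [h0 k hk]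
    · exact mul_le_mul_of_nonneg_right (hσ hk) (sq_nonneg _)
  rwa [((hasSum_sq α).mul_left (σ n)).tsum_eq, hα, one_pow, mul_one] at hle

/-- Extension by zero of a finite vector to a square-summable sequence. -/
noncomputable def extendByZero (m : ℕ) : (Fin m → ℝ) →ₗ[ℝ] lp (fun _ : ℕ => ℝ) 2 :=
  ∑ i : Fin m, lp.lsingle 2 (i : ℕ) ∘ₗ LinearMap.proj i

theorem extendByZero_apply {m : ℕ} (v : Fin m → ℝ) (k : ℕ) :
    extendByZero m v k = ∑ i : Fin m, if k = i then v i else 0 := by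
  rw [extendByZero, LinearMap.sum_apply, lp.coeFn_sum, Finset.sum_apply]
  simp [Pi.single_apply]

theorem extendByZero_apply_fin {m : ℕ} (v : Fin m → ℝ) (i : Fin m) :
    extendByZero m v i = v i := by
  simp [extendByZero_apply, Fin.val_inj]

theorem extendByZero_apply_of_le {m : ℕ} (v : Fin m → ℝ) {k : ℕ} (hk : m ≤ k) :
    extendByZero m v k = 0 := by
  rw [extendByZero_apply]
  exact Finset.sum_eq_zero fun i _ => if_neg (by omega)

theorem extendByZero_injective (m : ℕ) : Function.Injective (extendByZero m) := fun v w h => by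
  ext i
  rw [← extendByZero_apply_fin v, h, extendByZero_apply_fin]

theorem exists_norm_eq_one_mem_ker {n : ℕ}
    (Φ : lp (fun _ : ℕ => ℝ) 2 →L[ℝ] EuclideanSpace ℝ (Fin n)) :
    ∃ α : lp (fun _ : ℕ => ℝ) 2, ‖α‖ = 1 ∧ Φ α = 0 ∧ ∀ k, n < k → α k = 0 := by
  have hker : LinearMap.ker (Φ.toLinearMap ∘ₗ extendByZero (n + 1)) ≠ ⊥ :=
    LinearMap.ker_ne_bot_of_finrank_lt (by simp)
  obtain ⟨v, hv, hv0⟩ := Submodule.exists_mem_ne_zero_of_ne_bot hker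
  have hne : extendByZero (n + 1) v ≠ 0 := fun h =>
    hv0 (extendByZero_injective _ (h.trans (map_zero _).symm))
  refine ⟨‖extendByZero (n + 1) v‖⁻¹ • extendByZero (n + 1) v, ?_, ?_, fun k hk => ?_⟩
  · rw [norm_smul, norm_inv, norm_norm, inv_mul_cancel₀ (norm_ne_zero_iff.mpr hne)]
  · have : Φ (extendByZero (n + 1) v) = 0 := hv
    rw [map_smul, this, smul_zero]
  · rw [lp.coeFn_smul, Pi.smul_apply, extendByZero_apply_of_le v hk, smul_zero]

theorem le_sSup_ker {σ : ℕ → ℝ} (hσpos : ∀ k, 0 < σ k) (hσ : Antitone σ) {n : ℕ}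
    (Φ : lp (fun _ : ℕ => ℝ) 2 →L[ℝ] EuclideanSpace ℝ (Fin n)) :
    σ n ≤ sSup {r : ℝ | ∃ α : lp (fun _ : ℕ => ℝ) 2,
      ‖α‖ ≤ 1 ∧ Φ α = 0 ∧ r = ∑' k : ℕ, σ k * (α k) ^ 2} := by
  obtain ⟨α, hα, hΦ, h0⟩ := exists_norm_eq_one_mem_ker Φ
  refine (le_tsum_weighted_sq hσpos hσ hα h0).trans (le_csSup ⟨σ 0, ?_⟩ ⟨α, hα.le, hΦ, rfl⟩)
  rintro _ ⟨β, hβ, -, rfl⟩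
  exact tsum_weighted_sq_le hσpos hσ hβ (by simp)

theorem sSup_ker_truncation {σ : ℕ → ℝ} (hσpos : ∀ k, 0 < σ k) (hσ : Antitone σ) {n : ℕ}
    (Φ : lp (fun _ : ℕ => ℝ) 2 →L[ℝ] EuclideanSpace ℝ (Fin n))
    (hΦ : ∀ (α : lp (fun _ : ℕ => ℝ) 2) (i : Fin n), Φ α i = α (i : ℕ)) :
    sSup {r : ℝ | ∃ α : lp (fun _ : ℕ => ℝ) 2,
      ‖α‖ ≤ 1 ∧ Φ α = 0 ∧ r = ∑' k : ℕ, σ k * (α k) ^ 2} = σ n := by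
  refine le_antisymm (csSup_le ⟨_, 0, by simp, map_zero Φ, rfl⟩ ?_) (le_sSup_ker hσpos hσ Φ)
  rintro _ ⟨α, hα, hα0, rfl⟩
  refine tsum_weighted_sq_le hσpos hσ hα fun k hk => ?_
  rw [← hΦ α ⟨k, hk⟩, hα0, PiLp.zero_apply]

theorem surjective_truncation {n : ℕ}
    (Φ : lp (fun _ : ℕ => ℝ) 2 →L[ℝ] EuclideanSpace ℝ (Fin n))
    (hΦ : ∀ (α : lp (fun _ : ℕ => ℝ) 2) (i : Fin n), Φ α i = α (i : ℕ)) :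
    Function.Surjective Φ := fun y =>
  ⟨extendByZero n y, by ext i; rw [hΦ, extendByZero_apply_fin]⟩

theorem exists_truncation (n : ℕ) :
    ∃ Φ : lp (fun _ : ℕ => ℝ) 2 →L[ℝ] EuclideanSpace ℝ (Fin n),
      ∀ (α : lp (fun _ : ℕ => ℝ) 2) (i : Fin n), Φ α i = α (i : ℕ) :=
  ⟨(EuclideanSpace.equiv (Fin n) ℝ).symm.toContinuousLinearMap ∘L
    ContinuousLinearMap.pi fun i => lp.evalCLM ℝ (fun _ : ℕ => ℝ) 2 (i : ℕ), fun _ _ => rfl⟩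

end RealEllTwo


/-- minimax / n-width identity.
`σ` is a nonincreasing sequence of positive reals (0-indexed: `σ k` is the paper's
`σ_{k+1}`).  For a continuous linear operator `Φ : ℓ²(ℕ) → ℝⁿ`, let
`K Φ := sup { ∑ σ_k α_k² : ‖α‖_{ℓ²} ≤ 1, Φα = 0 }`.
Then `σ_{n+1}` is the least element of the set of values `K Φ` over all surjective
continuous linear operators `Φ` (so the infimum equals `σ_{n+1}` and is attained);
moreover any operator acting as the coordinate truncation `α ↦ (α₁, …, α_n)` is
surjective and attains it. -/
theorem stmt2
    (σ : ℕ → ℝ) (hσpos : ∀ k, 0 < σ k) (hσmono : ∀ k, σ (k + 1) ≤ σ k)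
    (n : ℕ) (hn : 1 ≤ n) :
    IsLeast {v : ℝ | ∃ Φ : lp (fun _ : ℕ => ℝ) 2 →L[ℝ] EuclideanSpace ℝ (Fin n),
        Function.Surjective Φ ∧
        v = sSup {r : ℝ | ∃ α : lp (fun _ : ℕ => ℝ) 2,
          ‖α‖ ≤ 1 ∧ Φ α = 0 ∧ r = ∑' k : ℕ, σ k * (α k) ^ 2}} (σ n) ∧
      ∀ Φ₀ : lp (fun _ : ℕ => ℝ) 2 →L[ℝ] EuclideanSpace ℝ (Fin n),
        (∀ (α : lp (fun _ : ℕ => ℝ) 2) (i : Fin n), Φ₀ α i = α (i : ℕ)) →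
        Function.Surjective Φ₀ ∧
          sSup {r : ℝ | ∃ α : lp (fun _ : ℕ => ℝ) 2,
            ‖α‖ ≤ 1 ∧ Φ₀ α = 0 ∧ r = ∑' k : ℕ, σ k * (α k) ^ 2} = σ n := by
  have hσ : Antitone σ := antitone_nat_of_succ_le hσmono
  obtain ⟨Φ, hΦ⟩ := RealEllTwo.exists_truncation n
  refine ⟨⟨⟨Φ, RealEllTwo.surjective_truncation Φ hΦ,
    (RealEllTwo.sSup_ker_truncation hσpos hσ Φ hΦ).symm⟩, ?_⟩, fun Φ₀ hΦ₀ =>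
    ⟨RealEllTwo.surjective_truncation Φ₀ hΦ₀,
      RealEllTwo.sSup_ker_truncation hσpos hσ Φ₀ hΦ₀⟩⟩
  rintro _ ⟨Ψ, -, rfl⟩
  exact RealEllTwo.le_sSup_ker hσpos hσ Ψ
end

section
/- For every integer n ≥ 1 and every real ε with 0 ≤ ε² ≤ σ₁, one has sup{Σ_{k≥1} σ_k α_k² : α ∈ ℓ², Σ_{k≥1} α_k² ≤ 1, Σ_{k=1}^{n} σ_k α_k² ≤ ε²} = (1 − σ_{n+1}/σ₁)·ε² + σ_{n+1}. -/
/-- Weighted sums of a nonnegative sequence of total mass at most one, with nonincreasing weights,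
are controlled by their first `n` terms. -/
theorem tsum_mul_le_of_antitone_weights {σ b : ℕ → ℝ} (hσpos : ∀ k, 0 < σ k) (hσ : Antitone σ)
    (hb : ∀ k, 0 ≤ b k) (hbs : Summable b) (hb1 : ∑' k, b k ≤ 1) (n : ℕ) :
    ∑' k, σ k * b k ≤ (1 - σ n / σ 0) * (∑ k ∈ Finset.range n, σ k * b k) + σ n := by
  have hs : Summable fun k => σ k * b k :=
    Summable.of_nonneg_of_le (fun k => mul_nonneg (hσpos k).le (hb k))
      (fun k => mul_le_mul_of_nonneg_right (hσ (Nat.zero_le k)) (hb k)) (hbs.mul_left (σ 0))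
  have hhead : (∑ k ∈ Finset.range n, σ k * b k) ≤ σ 0 * ∑ k ∈ Finset.range n, b k := by
    rw [Finset.mul_sum]
    exact Finset.sum_le_sum fun k _ => mul_le_mul_of_nonneg_right (hσ (Nat.zero_le k)) (hb k)
  have htail : ∑' k, σ (k + n) * b (k + n) ≤ σ n * ∑' k, b (k + n) := by
    rw [← tsum_mul_left]
    exact ((summable_nat_add_iff n).2 hs).tsum_le_tsum
      (fun k => mul_le_mul_of_nonneg_right (hσ (Nat.le_add_left n k)) (hb _))
      (((summable_nat_add_iff n).2 hbs).mul_left _)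
  have hsplit := hs.sum_add_tsum_nat_add n
  have hbsplit := hbs.sum_add_tsum_nat_add n
  have hmass : σ n / σ 0 * (∑ k ∈ Finset.range n, σ k * b k) ≤
      σ n * ∑ k ∈ Finset.range n, b k := by
    rw [div_mul_eq_mul_div, div_le_iff₀ (hσpos 0), mul_assoc, mul_comm _ (σ 0)]
    exact mul_le_mul_of_nonneg_left hhead (hσpos n).le
  have htotal : σ n * (∑ k ∈ Finset.range n, b k + ∑' k, b (k + n)) ≤ σ n * 1 :=
    mul_le_mul_of_nonneg_left (hbsplit.trans_le hb1) (hσpos n).le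
  linarith

/-- exact value for the generalized Fourier truncation operator.
`σ` is a nonincreasing sequence of positive reals (0-indexed: `σ k` is the paper's
`σ_{k+1}`).  For every `n ≥ 1` and every real `ε` with `ε² ≤ σ₁`,
`sup { ∑_{k≥1} σ_k α_k² : α ∈ ℓ², ∑_{k≥1} α_k² ≤ 1, ∑_{k=1}^n σ_k α_k² ≤ ε² }
  = (1 - σ_{n+1}/σ₁) ε² + σ_{n+1}`. -/
theorem stmt3
    (σ : ℕ → ℝ) (hσpos : ∀ k, 0 < σ k) (hσmono : ∀ k, σ (k + 1) ≤ σ k)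
    (n : ℕ) (hn : 1 ≤ n) (ε : ℝ) (hε : ε ^ 2 ≤ σ 0) :
    sSup {r : ℝ | ∃ α : ℕ → ℝ, Summable (fun k => α k ^ 2) ∧
        (∑' k : ℕ, α k ^ 2) ≤ 1 ∧
        (∑ k ∈ Finset.range n, σ k * α k ^ 2) ≤ ε ^ 2 ∧
        r = ∑' k : ℕ, σ k * α k ^ 2} =
      (1 - σ n / σ 0) * ε ^ 2 + σ n := by
  have hσ : Antitone σ := antitone_nat_of_succ_le hσmono
  have h0 := hσpos 0
  have hn0 : n ≠ 0 := by omega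
  have hratio : 0 ≤ 1 - σ n / σ 0 := by
    rw [sub_nonneg, div_le_one h0]
    exact hσ (Nat.zero_le n)
  apply IsGreatest.csSup_eq
  constructor
  · have hx : 0 ≤ ε ^ 2 / σ 0 := by positivity
    have hy : 0 ≤ 1 - ε ^ 2 / σ 0 := by rwa [sub_nonneg, div_le_one h0]
    let α : ℕ → ℝ := fun k =>
      if k = 0 then √(ε ^ 2 / σ 0) else if k = n then √(1 - ε ^ 2 / σ 0) else 0
    have hα0 : α 0 ^ 2 = ε ^ 2 / σ 0 := by simp only [α, if_true, Real.sq_sqrt hx]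
    have hαn : α n ^ 2 = 1 - ε ^ 2 / σ 0 := by
      simp only [α, if_neg hn0, if_true, Real.sq_sqrt hy]
    have hα : ∀ k, k ≠ 0 → k ≠ n → α k ^ 2 = 0 := fun k h h' => by simp [α, h, h']
    have hsum (w : ℕ → ℝ) : HasSum (fun k => w k * α k ^ 2) (w 0 * α 0 ^ 2 + w n * α n ^ 2) := by
      rw [← Finset.sum_pair (f := fun k => w k * α k ^ 2) hn0.symm]
      refine hasSum_sum_of_ne_finset_zero fun k hk => ?_
      simp only [Finset.mem_insert, Finset.mem_singleton, not_or] at hk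
      rw [hα k hk.1 hk.2, mul_zero]
    have hone : HasSum (fun k => α k ^ 2) 1 := by simpa [hα0, hαn] using hsum fun _ => 1
    refine ⟨α, hone.summable, hone.tsum_eq.le, ?_, ?_⟩
    · rw [Finset.sum_eq_single_of_mem 0 (Finset.mem_range.2 hn), hα0, mul_div_cancel₀ _ h0.ne']
      intro k hk hk0
      rw [hα k hk0 (Finset.mem_range.1 hk).ne, mul_zero]
    · rw [(hsum σ).tsum_eq, hα0, hαn]
      field_simp
      ring
  · rintro r ⟨α, hs, h1, hhead, rfl⟩
    refine (tsum_mul_le_of_antitone_weights hσpos hσ (fun k => sq_nonneg (α k)) hs h1 n).trans ?_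
    gcongr
end

section
/- Let α > 2, C > 0, let γ, η be positive integers and c₁, c₂ > 0. Then there exist a constant C′ > 0 and an integer n₀ ≥ 1, depending only on (α, C, γ, η, c₁, c₂), such that for every n ≥ n₀ the following holds. Suppose (σ_k)_{k≥1} are nonnegative reals with σ_k ≤ C·k^{−α} for all k, and (Ψ_{kℓ})_{k,ℓ>n} is a symmetric real array such that: (i) Ψ_{k,ℓ+γn} = Ψ_{k,ℓ} for all k, ℓ > n; (ii) for each k > n there is a set S_k ⊆ {1,…,γn} with |S_k| ≤ η such that |Ψ_{k,n+r}| ≤ c₁ for r ∈ S_k and |Ψ_{k,n+r}| ≤ c₂/n for r ∈ {1,…,γn}∖S_k; (iii) the weighted quadratic form q(x) := Σ_{k,ℓ>n} √σ_k·√σ_ℓ·Ψ_{kℓ}·x_k·x_ℓ is nonnegative for every finitely supported real sequence x = (x_k)_{k>n}. Then sup{ q(x) : x finitely supported, Σ_{k>n} x_k² ≤ 1 } ≤ C′·n^{−α}. -/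
/-- Splitting a sum over `M` consecutive periods of length `P` into its periods. -/
theorem sum_Ioc_mul_period (g : ℕ → ℝ) (n P M : ℕ) :
    ∑ l ∈ Finset.Ioc n (n + M * P), g l
      = ∑ j ∈ Finset.range M, ∑ r ∈ Finset.Icc 1 P, g (n + r + j * P) := by
  induction M with
  | zero => simp
  | succ M ih =>
    rw [Finset.sum_range_succ, ← ih,
      ← Finset.sum_Ioc_consecutive g (show n ≤ n + M * P by lia)
        (show n + M * P ≤ n + (M + 1) * P by nlinarith)]
    congr 1
    symm
    refine Finset.sum_nbij (fun r => n + r + M * P) ?_ ?_ ?_ (fun _ _ => rfl)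
    · intro r hr
      simp only [Finset.mem_Icc, Finset.mem_Ioc] at hr ⊢
      constructor <;> nlinarith
    · intro a _ b _ h
      simp only at h
      lia
    · intro l hl
      simp only [Finset.coe_Ioc, Set.mem_Ioc, Set.mem_image, Finset.coe_Icc, Set.mem_Icc] at hl ⊢
      have := Nat.succ_mul M P
      exact ⟨l - n - M * P, by lia, by lia⟩

/-- Schur's test for a real symmetric finite array with unit weights. -/
theorem schur_test_symm {ι : Type*} (T : Finset ι) (A : ι → ι → ℝ) (x : ι → ℝ) (B : ℝ)
    (hsymm : ∀ k ∈ T, ∀ l ∈ T, A k l = A l k) (hrow : ∀ k ∈ T, ∑ l ∈ T, |A k l| ≤ B) :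
    ∑ k ∈ T, ∑ l ∈ T, A k l * x k * x l ≤ B * ∑ k ∈ T, x k ^ 2 := by
  have hswap : ∑ k ∈ T, ∑ l ∈ T, |A k l| * x l ^ 2 = ∑ k ∈ T, ∑ l ∈ T, |A k l| * x k ^ 2 := by
    rw [Finset.sum_comm]
    exact Finset.sum_congr rfl fun k hk => Finset.sum_congr rfl fun l hl => by
      rw [hsymm l hl k hk]
  calc ∑ k ∈ T, ∑ l ∈ T, A k l * x k * x l
      ≤ ∑ k ∈ T, ∑ l ∈ T, (|A k l| * x k ^ 2 + |A k l| * x l ^ 2) / 2 := by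
        gcongr with k hk l hl
        rcases abs_cases (A k l) with ⟨h, h'⟩ | ⟨h, h'⟩ <;> rw [h]
        · nlinarith [mul_nonneg h' (sq_nonneg (x k - x l))]
        · nlinarith [mul_nonneg (neg_nonneg.2 h'.le) (sq_nonneg (x k + x l))]
    _ = ∑ k ∈ T, ∑ l ∈ T, |A k l| * x k ^ 2 := by
        simp_rw [← Finset.sum_div, Finset.sum_add_distrib]
        rw [hswap]
        ring
    _ = ∑ k ∈ T, (∑ l ∈ T, |A k l|) * x k ^ 2 := by simp_rw [Finset.sum_mul]
    _ ≤ ∑ k ∈ T, B * x k ^ 2 := by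
        gcongr with k hk
        exact hrow k hk
    _ = B * ∑ k ∈ T, x k ^ 2 := by rw [Finset.mul_sum]

theorem sum_le_of_sparse {ι : Type*} [DecidableEq ι] (I S : Finset ι) (f : ι → ℝ) (η : ℕ)
    (a b : ℝ) (ha : 0 ≤ a) (hb : 0 ≤ b) (hS : S ⊆ I) (hcard : S.card ≤ η)
    (hlarge : ∀ r ∈ S, f r ≤ a) (hsmall : ∀ r ∈ I, r ∉ S → f r ≤ b) :
    ∑ r ∈ I, f r ≤ η * a + I.card * b := by
  rw [← Finset.sum_sdiff hS, add_comm]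
  refine add_le_add ?_ ?_
  · refine (Finset.sum_le_card_nsmul S f a hlarge).trans ?_
    rw [nsmul_eq_mul]
    gcongr
  · refine (Finset.sum_le_card_nsmul (I \ S) f b fun r hr => ?_).trans ?_
    · rw [Finset.mem_sdiff] at hr
      exact hsmall r hr.1 hr.2
    · rw [nsmul_eq_mul]
      gcongr
      exact Finset.sdiff_subset

theorem sqrt_le_of_le_rpow_neg {s C α m k : ℝ} (hC : 0 ≤ C) (hα : 0 ≤ α) (hm : 0 < m)
    (hmk : m ≤ k) (hs : s ≤ C * k ^ (-α)) : √s ≤ √C * m ^ (-(α / 2)) := by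
  have hk : 0 < k := hm.trans_le hmk
  calc √s ≤ √(C * m ^ (-α)) := by
        refine Real.sqrt_le_sqrt (hs.trans ?_)
        gcongr ?_ * ?_
        exact Real.rpow_le_rpow_of_nonpos hm hmk (by linarith)
    _ = √C * m ^ (-(α / 2)) := by
        rw [Real.sqrt_mul hC, Real.sqrt_eq_rpow (m ^ (-α)), ← Real.rpow_mul hm.le]
        congr 2
        ring

/-- The weighted sum of a row over finitely many periods, given a bound `R` for the sum of the
absolute values over a single period of length `P ≥ n`. -/
theorem weighted_row_sum_le {C α R : ℝ} (hC : 0 ≤ C) (hα : 2 < α) (hR : 0 ≤ R)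
    {n P : ℕ} (hn : 1 ≤ n) (hP : n ≤ P) (M : ℕ) (σ ψ : ℕ → ℝ)
    (hσ : ∀ k : ℕ, 1 ≤ k → σ k ≤ C * (k : ℝ) ^ (-α))
    (hper : ∀ l, n < l → ψ (l + P) = ψ l)
    (hψ : ∑ r ∈ Finset.Icc 1 P, |ψ (n + r)| ≤ R) :
    ∑ l ∈ Finset.Ioc n (n + M * P), √(σ l) * |ψ l|
      ≤ √C * (n : ℝ) ^ (-(α / 2)) * R * ∑' j : ℕ, ((j : ℝ) + 1) ^ (-(α / 2)) := by
  have hn' : (0 : ℝ) < n := by exact_mod_cast hn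
  have hsum : Summable fun j : ℕ => ((j : ℝ) + 1) ^ (-(α / 2)) := by
    have h := (summable_nat_add_iff 1).2
      (Real.summable_nat_rpow.2 (show -(α / 2) < -1 by linarith))
    simpa using h
  have hshift : ∀ j r : ℕ, 1 ≤ r → ψ (n + r + j * P) = ψ (n + r) := by
    intro j r hr
    induction j with
    | zero => simp
    | succ j ih => rw [← ih, ← hper (n + r + j * P) (by lia)]; congr 1; ring
  rw [sum_Ioc_mul_period]
  calc ∑ j ∈ Finset.range M, ∑ r ∈ Finset.Icc 1 P,
          √(σ (n + r + j * P)) * |ψ (n + r + j * P)|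
      ≤ ∑ j ∈ Finset.range M, ∑ r ∈ Finset.Icc 1 P,
          √C * ((n : ℝ) * ((j : ℝ) + 1)) ^ (-(α / 2)) * |ψ (n + r)| := by
        refine Finset.sum_le_sum fun j _ => Finset.sum_le_sum fun r hr => ?_
        rw [hshift j r (Finset.mem_Icc.1 hr).1]
        refine mul_le_mul_of_nonneg_right ?_ (abs_nonneg _)
        refine sqrt_le_of_le_rpow_neg hC (by linarith) (by positivity) ?_ (hσ _ (by lia))
        have : n * (j + 1) ≤ n + r + j * P := by nlinarith [Nat.mul_le_mul_left j hP]
        exact_mod_cast this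
    _ = ∑ j ∈ Finset.range M, √C * (n : ℝ) ^ (-(α / 2)) *
          (∑ r ∈ Finset.Icc 1 P, |ψ (n + r)|) * ((j : ℝ) + 1) ^ (-(α / 2)) := by
        refine Finset.sum_congr rfl fun j _ => ?_
        rw [← Finset.mul_sum, Real.mul_rpow hn'.le (by positivity)]
        ring
    _ ≤ ∑ j ∈ Finset.range M, √C * (n : ℝ) ^ (-(α / 2)) * R *
          ((j : ℝ) + 1) ^ (-(α / 2)) := by gcongr
    _ ≤ _ := by
        rw [← Finset.mul_sum]
        gcongr
        exact hsum.sum_le_tsum _ fun j _ => by positivity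

/-- sparse periodic lemma, part (a), `α > 2`.
`Ψ` is the tail block (indices `> n`) of a Gram-type matrix: symmetric, with rows periodic
of period `γ n`, having in each period at most `η` entries of size `≤ c₁` and all the others
of size `≤ c₂ / n`; the weights satisfy `σ_k ≤ C k^{-α}`, and the weighted quadratic form
`q(x) = ∑_{k,ℓ>n} √σ_k √σ_ℓ Ψ_{kℓ} x_k x_ℓ` is positive semidefinite on finitely supported
sequences.  Then `λ_max`, i.e. the supremum of `q` over the unit ball of finitely supported
sequences vanishing on indices `≤ n`, is at most `C' n^{-α}` for all `n ≥ n₀`, where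
`C' > 0` and `n₀ ≥ 1` depend only on `(α, C, γ, η, c₁, c₂)`. -/
theorem stmt7
    (α C : ℝ) (hα : 2 < α) (hC : 0 < C)
    (γ η : ℕ) (hγ : 1 ≤ γ) (hη : 1 ≤ η)
    (c₁ c₂ : ℝ) (hc₁ : 0 < c₁) (hc₂ : 0 < c₂) :
    ∃ (C' : ℝ) (n₀ : ℕ), 0 < C' ∧ 1 ≤ n₀ ∧
      ∀ n : ℕ, n₀ ≤ n →
      ∀ (σ : ℕ → ℝ) (Ψ : ℕ → ℕ → ℝ),
        (∀ k : ℕ, 1 ≤ k → 0 ≤ σ k ∧ σ k ≤ C * (k : ℝ) ^ (-α)) →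
        (∀ k ℓ : ℕ, n < k → n < ℓ → Ψ k ℓ = Ψ ℓ k) →
        (∀ k ℓ : ℕ, n < k → n < ℓ → Ψ k (ℓ + γ * n) = Ψ k ℓ) →
        (∀ k : ℕ, n < k → ∃ S : Finset ℕ, S ⊆ Finset.Icc 1 (γ * n) ∧ S.card ≤ η ∧
          (∀ r ∈ S, |Ψ k (n + r)| ≤ c₁) ∧
          (∀ r ∈ Finset.Icc 1 (γ * n), r ∉ S → |Ψ k (n + r)| ≤ c₂ / n)) →
        (∀ x : ℕ → ℝ, (Function.support x).Finite → (∀ k ≤ n, x k = 0) →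
          0 ≤ ∑' k : ℕ, ∑' ℓ : ℕ,
            Real.sqrt (σ k) * Real.sqrt (σ ℓ) * Ψ k ℓ * x k * x ℓ) →
        ∀ x : ℕ → ℝ, (Function.support x).Finite → (∀ k ≤ n, x k = 0) →
          (∑' k : ℕ, x k ^ 2) ≤ 1 →
          (∑' k : ℕ, ∑' ℓ : ℕ,
              Real.sqrt (σ k) * Real.sqrt (σ ℓ) * Ψ k ℓ * x k * x ℓ)
            ≤ C' * (n : ℝ) ^ (-α) := by
  have hZ : 0 ≤ ∑' j : ℕ, ((j : ℝ) + 1) ^ (-(α / 2)) := tsum_nonneg fun j => by positivity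
  set Z := ∑' j : ℕ, ((j : ℝ) + 1) ^ (-(α / 2))
  have hR : 0 ≤ η * c₁ + γ * c₂ := by positivity
  refine ⟨C * (η * c₁ + γ * c₂) * Z + 1, 1, by positivity, le_rfl, ?_⟩
  intro n hn σ Ψ hσ hsymm hper hsparse _ x hfin hx0 hx1
  have hn' : (0 : ℝ) < n := by exact_mod_cast hn
  have hnP : n ≤ γ * n := Nat.le_mul_of_pos_left n hγ
  obtain ⟨M, hM⟩ := hfin.bddAbove
  set T := Finset.Ioc n (n + M * (γ * n))
  have hxT : ∀ k ∉ T, x k = 0 := by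
    intro k hk
    by_contra hne
    have hkM : k ≤ M := hM hne
    have hnk : n < k := by
      by_contra h
      exact hne (hx0 k (not_lt.1 h))
    refine hk (Finset.mem_Ioc.2 ⟨hnk, ?_⟩)
    nlinarith [Nat.mul_le_mul_left M (hn.trans hnP)]
  have hq : (∑' k : ℕ, ∑' ℓ : ℕ, √(σ k) * √(σ ℓ) * Ψ k ℓ * x k * x ℓ)
      = ∑ k ∈ T, ∑ ℓ ∈ T, √(σ k) * √(σ ℓ) * Ψ k ℓ * x k * x ℓ := by
    rw [tsum_eq_sum (s := T) fun k hk => by simp [hxT k hk]]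
    exact Finset.sum_congr rfl fun k _ => tsum_eq_sum fun l hl => by simp [hxT l hl]
  rw [tsum_eq_sum (s := T) fun k hk => by simp [hxT k hk]] at hx1
  have hrow : ∀ k ∈ T, ∑ l ∈ T, |√(σ k) * √(σ l) * Ψ k l|
      ≤ C * (η * c₁ + γ * c₂) * Z * (n : ℝ) ^ (-α) := by
    intro k hk
    have hnk : n < k := (Finset.mem_Ioc.1 hk).1
    obtain ⟨S, hS, hcard, hlarge, hsmall⟩ := hsparse k hnk
    have hperiod : ∑ r ∈ Finset.Icc 1 (γ * n), |Ψ k (n + r)| ≤ η * c₁ + γ * c₂ := by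
      refine (sum_le_of_sparse _ S _ η c₁ (c₂ / n) hc₁.le (by positivity) hS hcard
        hlarge hsmall).trans_eq ?_
      rw [Nat.card_Icc, Nat.add_sub_cancel]
      push_cast
      field_simp
    have hσk : √(σ k) ≤ √C * (n : ℝ) ^ (-(α / 2)) :=
      sqrt_le_of_le_rpow_neg hC.le (by linarith) hn' (by exact_mod_cast hnk.le)
        (hσ k (by lia)).2
    calc ∑ l ∈ T, |√(σ k) * √(σ l) * Ψ k l|
        = √(σ k) * ∑ l ∈ T, √(σ l) * |Ψ k l| := by
          rw [Finset.mul_sum]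
          refine Finset.sum_congr rfl fun l _ => ?_
          rw [abs_mul, abs_of_nonneg (by positivity), mul_assoc]
      _ ≤ (√C * (n : ℝ) ^ (-(α / 2))) *
            (√C * (n : ℝ) ^ (-(α / 2)) * (η * c₁ + γ * c₂) * Z) :=
          mul_le_mul hσk
            (weighted_row_sum_le hC.le hα hR hn hnP M σ (Ψ k) (fun k hk => (hσ k hk).2)
              (fun l hl => hper k l hnk hl) hperiod)
            (Finset.sum_nonneg fun l _ => by positivity) (by positivity)
      _ = (√C * √C) * (η * c₁ + γ * c₂) * Z *
            ((n : ℝ) ^ (-(α / 2)) * (n : ℝ) ^ (-(α / 2))) := by ring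
      _ = C * (η * c₁ + γ * c₂) * Z * (n : ℝ) ^ (-α) := by
          rw [Real.mul_self_sqrt hC.le, ← Real.rpow_add hn']
          congr 2
          ring
  rw [hq]
  refine (schur_test_symm T (fun k l => √(σ k) * √(σ l) * Ψ k l) x _ ?_ hrow).trans ?_
  · intro k hk l hl
    rw [hsymm k l (Finset.mem_Ioc.1 hk).1 (Finset.mem_Ioc.1 hl).1, mul_comm √(σ k)]
  · refine (mul_le_of_le_one_right (by positivity) hx1).trans ?_
    gcongr
    linarith
end

section
/- Suppose there exist ρ² ∈ (0,1) and κ² > 0 such that ⟨x, Ax⟩ + 2⟨x, Cy⟩ + (1−ρ²)⟨y, Dy⟩ + κ²·‖y‖² ≥ 0 for all x ∈ E and y ∈ F. Then for all x ∈ E and y ∈ F: ⟨x, Ax⟩ + 2⟨x, Cy⟩ + ⟨y, Dy⟩ ≥ ρ²·⟨x, Ax⟩ − (κ²/(1−ρ²))·‖y‖². -/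
open scoped RealInnerProductSpace

/-- quadratic inequality for block forms.
`E`, `F` are real inner product spaces, `A : E → E` and `D : F → F` are continuous
symmetric linear operators and `C : F → E` is a continuous linear operator.  If for some
`ρ² ∈ (0,1)` and `κ² > 0` the modified block form
`⟨x, Ax⟩ + 2⟨x, Cy⟩ + (1-ρ²)⟨y, Dy⟩ + κ²‖y‖²` is nonnegative for all `x, y`, then
`⟨x, Ax⟩ + 2⟨x, Cy⟩ + ⟨y, Dy⟩ ≥ ρ²⟨x, Ax⟩ - (κ²/(1-ρ²))‖y‖²` for all `x, y`. -/
theorem stmt9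
    {E F : Type*} [NormedAddCommGroup E] [InnerProductSpace ℝ E]
    [NormedAddCommGroup F] [InnerProductSpace ℝ F]
    (A : E →L[ℝ] E) (D : F →L[ℝ] F) (C : F →L[ℝ] E)
    (hA : ∀ x y : E, ⟪A x, y⟫ = ⟪x, A y⟫)
    (hD : ∀ x y : F, ⟪D x, y⟫ = ⟪x, D y⟫)
    (ρ2 κ2 : ℝ) (hρ0 : 0 < ρ2) (hρ1 : ρ2 < 1) (hκ : 0 < κ2)
    (hpsd : ∀ (x : E) (y : F),
      0 ≤ ⟪x, A x⟫ + 2 * ⟪x, C y⟫ + (1 - ρ2) * ⟪y, D y⟫ + κ2 * ‖y‖ ^ 2) :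
    ∀ (x : E) (y : F),
      ρ2 * ⟪x, A x⟫ - κ2 / (1 - ρ2) * ‖y‖ ^ 2
        ≤ ⟪x, A x⟫ + 2 * ⟪x, C y⟫ + ⟪y, D y⟫ := by
  intro x y
  have hs : 0 < 1 - ρ2 := sub_pos.mpr hρ1
  have h := hpsd ((1 - ρ2) • x) y
  simp only [map_smul, real_inner_smul_left, real_inner_smul_right] at h
  have key : ⟪x, A x⟫ + 2 * ⟪x, C y⟫ + ⟪y, D y⟫ - (ρ2 * ⟪x, A x⟫ - κ2 / (1 - ρ2) * ‖y‖ ^ 2)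
      = ((1 - ρ2) * ((1 - ρ2) * ⟪x, A x⟫) + 2 * ((1 - ρ2) * ⟪x, C y⟫)
          + (1 - ρ2) * ⟪y, D y⟫ + κ2 * ‖y‖ ^ 2) / (1 - ρ2) := by
    field_simp
    ring
  exact sub_nonneg.mp (key ▸ div_nonneg h hs.le)
end

section
/- Suppose the full quadratic form is positive semidefinite, i.e. ⟨x, Ax⟩ + 2⟨x, Cy⟩ + ⟨y, Dy⟩ ≥ 0 for all x ∈ E, y ∈ F, and suppose ρ² ∈ (0,1), κ² > 0 satisfy ρ²·⟨y, Dy⟩ ≤ κ²·‖y‖² for all y ∈ F (i.e. ρ²·λ_max(D) ≤ κ²). Then for all x ∈ E and y ∈ F: ⟨x, Ax⟩ + 2⟨x, Cy⟩ + ⟨y, Dy⟩ ≥ ρ²·⟨x, Ax⟩ − (κ²/(1−ρ²))·‖y‖². -/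
open scoped RealInnerProductSpace

/-- quadratic inequality under the sufficient condition
`ρ² λ_max(D) ≤ κ²`.
`E`, `F` are real inner product spaces, `A : E → E` and `D : F → F` are continuous
symmetric linear operators and `C : F → E` is a continuous linear operator.  If the full
block form `⟨x, Ax⟩ + 2⟨x, Cy⟩ + ⟨y, Dy⟩` is nonnegative for all `x, y`, and
`ρ² ∈ (0,1)`, `κ² > 0` satisfy `ρ²⟨y, Dy⟩ ≤ κ²‖y‖²` for all `y` (i.e.
`ρ² λ_max(D) ≤ κ²`), then
`⟨x, Ax⟩ + 2⟨x, Cy⟩ + ⟨y, Dy⟩ ≥ ρ²⟨x, Ax⟩ - (κ²/(1-ρ²))‖y‖²` for all `x, y`. -/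
theorem stmt10
    {E F : Type*} [NormedAddCommGroup E] [InnerProductSpace ℝ E]
    [NormedAddCommGroup F] [InnerProductSpace ℝ F]
    (A : E →L[ℝ] E) (D : F →L[ℝ] F) (C : F →L[ℝ] E)
    (hA : ∀ x y : E, ⟪A x, y⟫ = ⟪x, A y⟫)
    (hD : ∀ x y : F, ⟪D x, y⟫ = ⟪x, D y⟫)
    (ρ2 κ2 : ℝ) (hρ0 : 0 < ρ2) (hρ1 : ρ2 < 1) (hκ : 0 < κ2)
    (hpsd : ∀ (x : E) (y : F),
      0 ≤ ⟪x, A x⟫ + 2 * ⟪x, C y⟫ + ⟪y, D y⟫)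
    (hDbound : ∀ y : F, ρ2 * ⟪y, D y⟫ ≤ κ2 * ‖y‖ ^ 2) :
    ∀ (x : E) (y : F),
      ρ2 * ⟪x, A x⟫ - κ2 / (1 - ρ2) * ‖y‖ ^ 2
        ≤ ⟪x, A x⟫ + 2 * ⟪x, C y⟫ + ⟪y, D y⟫ := by
  intro x y
  have ht : 0 < 1 - ρ2 := sub_pos.mpr hρ1
  have h := hpsd x ((1 - ρ2)⁻¹ • y)
  simp only [map_smul, inner_smul_left, inner_smul_right, RCLike.conj_to_real] at h
  have h₁ := mul_nonneg ht.le h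
  have h₂ := mul_le_mul_of_nonneg_left (hDbound y) (inv_nonneg.mpr ht.le)
  have e₁ : (1 - ρ2) * (⟪x, A x⟫ + 2 * ((1 - ρ2)⁻¹ * ⟪x, C y⟫)
      + (1 - ρ2)⁻¹ * ((1 - ρ2)⁻¹ * ⟪y, D y⟫))
      = (1 - ρ2) * ⟪x, A x⟫ + 2 * ⟪x, C y⟫ + ⟪y, D y⟫ + (1 - ρ2)⁻¹ * (ρ2 * ⟪y, D y⟫) := by
    field_simp
    ring
  have e₂ : κ2 / (1 - ρ2) * ‖y‖ ^ 2 = (1 - ρ2)⁻¹ * (κ2 * ‖y‖ ^ 2) := by ring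
  linarith
end

section
/- Let u, v be real numbers with 0 ≤ v² ≤ u² and u² > 0, and let ε be a real number with 0 ≤ ε² ≤ u². Then sup{ t²·u² + s²·v² : t, s ∈ ℝ, t² + s² ≤ 1, t²·u² ≤ ε² } = v² + (1 − v²/u²)·ε². -/
/-- the 2×2 subproblem for Fourier truncation.
For reals `u, v, ε` with `0 < u²`, `v² ≤ u²` and `ε² ≤ u²`,
`sup { t² u² + s² v² : t² + s² ≤ 1, t² u² ≤ ε² } = v² + (1 - v²/u²) ε²`. -/
theorem stmt14 (u v ε : ℝ) (hu : 0 < u ^ 2) (hvu : v ^ 2 ≤ u ^ 2)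
    (hε : ε ^ 2 ≤ u ^ 2) :
    sSup {r : ℝ | ∃ t s : ℝ, t ^ 2 + s ^ 2 ≤ 1 ∧ t ^ 2 * u ^ 2 ≤ ε ^ 2 ∧
        r = t ^ 2 * u ^ 2 + s ^ 2 * v ^ 2}
      = v ^ 2 + (1 - v ^ 2 / u ^ 2) * ε ^ 2 := by
  have hu0 : u ≠ 0 := fun h => by simp [h] at hu
  have hc : 0 ≤ 1 - v ^ 2 / u ^ 2 := sub_nonneg.mpr ((div_le_one hu).mpr hvu)
  apply IsGreatest.csSup_eq
  constructor
  · have hs : 0 ≤ 1 - (ε / u) ^ 2 := by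
      rw [div_pow]
      exact sub_nonneg.mpr ((div_le_one hu).mpr hε)
    refine ⟨ε / u, √(1 - (ε / u) ^ 2), ?_, ?_, ?_⟩
    · rw [Real.sq_sqrt hs]
      linarith
    · rw [div_pow, div_mul_cancel₀ _ hu.ne']
    · rw [Real.sq_sqrt hs]
      field_simp
      ring
  · rintro r ⟨t, s, hts, ht, rfl⟩
    calc t ^ 2 * u ^ 2 + s ^ 2 * v ^ 2
        ≤ t ^ 2 * u ^ 2 + (1 - t ^ 2) * v ^ 2 := by
          gcongr
          linarith
      _ = v ^ 2 + (1 - v ^ 2 / u ^ 2) * (t ^ 2 * u ^ 2) := by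
          field_simp
          ring
      _ ≤ v ^ 2 + (1 - v ^ 2 / u ^ 2) * ε ^ 2 := by gcongr
end

section
/- Let (σ_j)_{j≥1} be a nonincreasing summable sequence of positive reals and n ≥ 1. Define G_n(ε) := n^{−1/2}·√(Σ_{j≥1} min{σ_j, ε²}), the critical radius r_n := inf{ε > 0 : G_n(ε) ≤ ε²}, and μ(ε) := min{p ≥ 1 : σ_p ≤ ε²}. If r_n > 0, then for every ε ≥ r_n with ε² < σ₁ one has μ(ε) ≤ 2·n·r_n². -/
/-- bound on `μ(ε)` via the critical radius.
`σ` is a nonincreasing summable sequence of positive reals (0-indexed: `σ j` is the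
paper's `σ_{j+1}`), `G` is the localized complexity,
`rn = inf {ε > 0 : G(ε) ≤ ε²}` is the critical radius, and `μ` is the least integer
`p ≥ 1` with `σ_p ≤ ε²` (paper indexing: `σ (μ - 1) ≤ ε²` and `σ (q-1) > ε²` for
`1 ≤ q < μ`).  If `rn > 0`, then for every `ε ≥ rn` with `ε² < σ₁` one has
`μ(ε) ≤ 2 n rn²`. -/
theorem stmt18
    (σ : ℕ → ℝ) (hσpos : ∀ j, 0 < σ j) (hσmono : ∀ j, σ (j + 1) ≤ σ j)
    (hsum : Summable σ) (n : ℕ) (hn : 1 ≤ n)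
    (G : ℝ → ℝ)
    (hG : ∀ ε : ℝ, G ε = (Real.sqrt n)⁻¹ * Real.sqrt (∑' j : ℕ, min (σ j) (ε ^ 2)))
    (rn : ℝ) (hrn_def : rn = sInf {ε : ℝ | 0 < ε ∧ G ε ≤ ε ^ 2}) (hrn : 0 < rn)
    (ε : ℝ) (hε1 : rn ≤ ε) (hε2 : ε ^ 2 < σ 0)
    (μ : ℕ) (hμ1 : 1 ≤ μ) (hμ2 : σ (μ - 1) ≤ ε ^ 2)
    (hμ3 : ∀ q : ℕ, 1 ≤ q → q < μ → ε ^ 2 < σ (q - 1)) :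
    (μ : ℝ) ≤ 2 * (n : ℝ) * rn ^ 2 := by
  have hne : {x : ℝ | 0 < x ∧ G x ≤ x ^ 2}.Nonempty := by
    by_contra h
    rw [Set.not_nonempty_iff_eq_empty] at h
    rw [h, Real.sInf_empty] at hrn_def
    linarith
  have hbdd : BddBelow {x : ℝ | 0 < x ∧ G x ≤ x ^ 2} := ⟨0, fun x hx => hx.1.le⟩
  have hn0 : (0 : ℝ) < n := by exact_mod_cast hn
  obtain ⟨k, rfl⟩ : ∃ k, μ = k + 1 := ⟨μ - 1, by omega⟩
  rw [Nat.add_sub_cancel] at hμ2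
  have hk : 1 ≤ k := by
    by_contra h
    obtain rfl : k = 0 := by omega
    linarith
  have hbig : ∀ j < k, ε ^ 2 < σ j := fun j hj => by
    simpa using hμ3 (j + 1) (by omega) (by omega)
  have hε : rn ^ 2 ≤ ε ^ 2 := by gcongr
  have hmem : ∀ x, 0 < x → G x ≤ x ^ 2 → (k : ℝ) * rn ^ 2 ≤ n * (x ^ 2) ^ 2 := by
    intro x hx hGx
    have hxr : rn ≤ x := hrn_def ▸ csInf_le hbdd ⟨hx, hGx⟩
    have hnonneg : ∀ j, 0 ≤ min (σ j) (x ^ 2) := fun j => le_min (hσpos j).le (sq_nonneg x)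
    have hs : Summable fun j => min (σ j) (x ^ 2) :=
      hsum.of_nonneg_of_le hnonneg fun j => min_le_left _ _
    have hlow : (k : ℝ) * rn ^ 2 ≤ ∑' j, min (σ j) (x ^ 2) := by
      calc (k : ℝ) * rn ^ 2 = ∑ _j ∈ Finset.range k, rn ^ 2 := by simp
        _ ≤ ∑ j ∈ Finset.range k, min (σ j) (x ^ 2) :=
          Finset.sum_le_sum fun j hj =>
            le_min (hε.trans (hbig j (Finset.mem_range.1 hj)).le) (by gcongr)
        _ ≤ _ := hs.sum_le_tsum _ fun j _ => hnonneg j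
    rw [hG, inv_mul_le_iff₀ (Real.sqrt_pos.2 hn0)] at hGx
    have hsq := Real.sqrt_le_iff.1 hGx
    rw [mul_pow, Real.sq_sqrt hn0.le] at hsq
    exact hlow.trans hsq.2
  have hroot : √√((k : ℝ) * rn ^ 2 / n) ≤ rn := by
    conv_rhs => rw [hrn_def]
    refine le_csInf hne fun x hx => ?_
    refine Real.sqrt_le_iff.2 ⟨hx.1.le, Real.sqrt_le_iff.2 ⟨sq_nonneg x, ?_⟩⟩
    rw [div_le_iff₀ hn0, mul_comm _ (n : ℝ)]
    exact hmem x hx.1 hx.2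
  have hfour : (k : ℝ) * rn ^ 2 ≤ (n * rn ^ 2) * rn ^ 2 := by
    have h := (Real.sqrt_le_iff.1 (Real.sqrt_le_iff.1 hroot).2).2
    rw [div_le_iff₀ hn0] at h
    linarith
  have hkn : (k : ℝ) ≤ n * rn ^ 2 := le_of_mul_le_mul_right hfour (by positivity)
  have hk1 : (1 : ℝ) ≤ k := by exact_mod_cast hk
  push_cast
  linarith
end

section
/- There exist a constant C > 0 and an integer n₀ ≥ 2 such that for every integer n ≥ n₀, every ε ≥ 0, and every g ∈ L²([0,1]) with ∫₀¹ g(t)² dt ≤ 1, the function f(x) := ∫₀ˣ g(t) dt satisfies: if (1/n)·Σ_{i=1}^{n} f(i/n)² ≤ ε², then ∫₀¹ f(x)² dx ≤ 2·ε² + C·n^{−2}·log n. -/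
open MeasureTheory

/-- Cauchy–Schwarz for an interval integral against the constant function `1`. -/
theorem sq_intervalIntegral_le {g : ℝ → ℝ} {a b : ℝ} (hab : a ≤ b)
    (hg : IntervalIntegrable g volume a b)
    (hg2 : IntervalIntegrable (fun t => g t ^ 2) volume a b) :
    (∫ t in a..b, g t) ^ 2 ≤ (b - a) * ∫ t in a..b, g t ^ 2 := by
  rcases hab.eq_or_lt with rfl | hlt
  · simp
  set I := ∫ t in a..b, g t
  have hI1 : IntervalIntegrable (fun t => (2 * (b - a) * I) * g t) volume a b := hg.const_mul _
  have hI2 : IntervalIntegrable (fun t => (b - a) ^ 2 * g t ^ 2) volume a b := hg2.const_mul _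
  have h0 : 0 ≤ ∫ t in a..b, ((b - a) * g t - I) ^ 2 :=
    intervalIntegral.integral_nonneg hab fun t _ => sq_nonneg _
  have h1 : ∫ t in a..b, ((b - a) * g t - I) ^ 2
      = (b - a) * ((b - a) * (∫ t in a..b, g t ^ 2) - I ^ 2) := by
    have hfun : (fun t => ((b - a) * g t - I) ^ 2)
        = fun t => (b - a) ^ 2 * g t ^ 2 - (2 * (b - a) * I) * g t + I ^ 2 := by
      funext t; ring
    rw [hfun, intervalIntegral.integral_add (hI2.sub hI1) intervalIntegrable_const,
      intervalIntegral.integral_sub hI2 hI1, intervalIntegral.integral_const_mul,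
      intervalIntegral.integral_const_mul, intervalIntegral.integral_const, smul_eq_mul]
    ring
  rw [h1] at h0
  linarith [nonneg_of_mul_nonneg_right h0 (sub_pos.2 hlt)]

/-- On an interval, the squared `L²` norm of a primitive is controlled by its value at the right
endpoint and the energy of its derivative. -/
theorem intervalIntegral_sq_primitive_le {g : ℝ → ℝ} {c a b : ℝ} (hca : c ≤ a) (hab : a ≤ b)
    (hg : IntervalIntegrable g volume c b)
    (hg2 : IntervalIntegrable (fun t => g t ^ 2) volume c b)
    (hf : IntervalIntegrable (fun x => (∫ t in c..x, g t) ^ 2) volume a b) :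
    (∫ x in a..b, (∫ t in c..x, g t) ^ 2)
      ≤ (b - a) * (2 * (∫ t in c..b, g t) ^ 2 + 2 * ((b - a) * ∫ t in a..b, g t ^ 2)) := by
  have hcb := hca.trans hab
  have key : ∀ x ∈ Set.Icc a b, (∫ t in c..x, g t) ^ 2
      ≤ 2 * (∫ t in c..b, g t) ^ 2 + 2 * ((b - a) * ∫ t in a..b, g t ^ 2) := by
    rintro x ⟨hax, hxb⟩
    have hsub : ∀ {y z : ℝ}, c ≤ y → y ≤ z → z ≤ b → Set.uIcc y z ⊆ Set.uIcc c b := by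
      intro y z hy hyz hz
      rw [Set.uIcc_of_le hyz, Set.uIcc_of_le hcb]
      exact Set.Icc_subset_Icc hy hz
    have hcx := hca.trans hax
    have hsplit := intervalIntegral.integral_add_adjacent_intervals
      (hg.mono_set (hsub le_rfl hcx hxb)) (hg.mono_set (hsub hcx hxb le_rfl))
    have hsplit2 := intervalIntegral.integral_add_adjacent_intervals
      (hg2.mono_set (hsub hca hax hxb)) (hg2.mono_set (hsub hcx hxb le_rfl))
    have hcs := sq_intervalIntegral_le hxb (hg.mono_set (hsub hcx hxb le_rfl))
      (hg2.mono_set (hsub hcx hxb le_rfl))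
    have hn1 : 0 ≤ ∫ t in a..x, g t ^ 2 :=
      intervalIntegral.integral_nonneg hax fun t _ => sq_nonneg _
    have hn2 : 0 ≤ ∫ t in x..b, g t ^ 2 :=
      intervalIntegral.integral_nonneg hxb fun t _ => sq_nonneg _
    have hmono : (b - x) * (∫ t in x..b, g t ^ 2) ≤ (b - a) * ∫ t in a..b, g t ^ 2 :=
      mul_le_mul (by linarith) (by linarith) hn2 (by linarith)
    have hsq : (∫ t in c..x, g t) ^ 2
        ≤ 2 * (∫ t in c..b, g t) ^ 2 + 2 * (∫ t in x..b, g t) ^ 2 := by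
      rw [← hsplit]
      nlinarith [sq_nonneg ((∫ t in c..x, g t) + 2 * ∫ t in x..b, g t)]
    linarith
  calc _ ≤ ∫ _ in a..b, (2 * (∫ t in c..b, g t) ^ 2 + 2 * ((b - a) * ∫ t in a..b, g t ^ 2)) :=
        intervalIntegral.integral_mono_on hab hf intervalIntegrable_const key
    _ = _ := by rw [intervalIntegral.integral_const, smul_eq_mul]

/-- Sobolev-kernel example: `R_Φ(ε) ≤ 2ε² + O(n⁻² log n)`.
There are `C > 0` and `n₀ ≥ 2` such that for all `n ≥ n₀`, all `ε ≥ 0` and all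
`g ∈ L²([0,1])` with `∫₀¹ g² ≤ 1`, the function `f(x) = ∫₀ˣ g` (a generic element of the
unit ball of the first-order Sobolev RKHS of the kernel `min(x,y)`) satisfies: if
`n⁻¹ ∑_{i=1}^n f(i/n)² ≤ ε²` then `∫₀¹ f² ≤ 2ε² + C n⁻² log n`. -/
theorem stmt19 :
    ∃ (C : ℝ) (n₀ : ℕ), 0 < C ∧ 2 ≤ n₀ ∧
      ∀ n : ℕ, n₀ ≤ n → ∀ ε : ℝ, 0 ≤ ε →
      ∀ g : ℝ → ℝ,
        IntervalIntegrable g volume 0 1 →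
        IntervalIntegrable (fun t => g t ^ 2) volume 0 1 →
        (∫ t in (0:ℝ)..1, g t ^ 2) ≤ 1 →
        ((n : ℝ)⁻¹ * ∑ i ∈ Finset.Icc 1 n,
            (∫ t in (0:ℝ)..((i : ℝ) / (n : ℝ)), g t) ^ 2) ≤ ε ^ 2 →
        (∫ x in (0:ℝ)..1, (∫ t in (0:ℝ)..x, g t) ^ 2)
          ≤ 2 * ε ^ 2 + C * Real.log n / (n : ℝ) ^ 2 := by
  refine ⟨2, 3, by norm_num, by norm_num, ?_⟩
  intro n hn ε _ g hg hg2 hg1 hsum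
  have hn0 : (0 : ℝ) < n := by exact_mod_cast (by omega : 0 < n)
  have hF : ContinuousOn (fun x => (∫ t in (0:ℝ)..x, g t) ^ 2) (Set.uIcc (0:ℝ) 1) :=
    (intervalIntegral.continuousOn_primitive_interval
      ((intervalIntegrable_iff' (by simp)).1 hg)).pow 2
  have hFi := hF.intervalIntegrable (μ := volume)
  let a : ℕ → ℝ := fun k => (k : ℝ) / n
  have ha0 : a 0 = 0 := by simp [a]
  have han : a n = 1 := div_self hn0.ne'
  have hmono : Monotone a := fun i j hij =>
    div_le_div_of_nonneg_right (by exact_mod_cast hij) hn0.le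
  have hstep : ∀ k, a (k + 1) - a k = (n : ℝ)⁻¹ := by
    intro k; simp only [a]; push_cast; field_simp; ring
  have hnn : ∀ k, 0 ≤ a k := fun k => by positivity
  have hle : ∀ k < n, a (k + 1) ≤ 1 := fun k hk => han ▸ hmono hk
  have hsub : ∀ k < n, Set.uIcc (a k) (a (k + 1)) ⊆ Set.uIcc 0 1 := by
    intro k hk
    rw [Set.uIcc_of_le (hmono k.le_succ), Set.uIcc_of_le zero_le_one]
    exact Set.Icc_subset_Icc (hnn k) (hle k hk)
  have hsub0 : ∀ k < n, Set.uIcc 0 (a (k + 1)) ⊆ Set.uIcc 0 1 := by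
    intro k hk
    rw [Set.uIcc_of_le (hnn _), Set.uIcc_of_le zero_le_one]
    exact Set.Icc_subset_Icc le_rfl (hle k hk)
  have hsumF := intervalIntegral.sum_integral_adjacent_intervals (n := n)
    fun k hk => hFi.mono_set (hsub k hk)
  have hsumG := intervalIntegral.sum_integral_adjacent_intervals (n := n)
    fun k hk => hg2.mono_set (hsub k hk)
  rw [ha0, han] at hsumF hsumG
  have hlog : 1 ≤ Real.log n := by
    rw [Real.le_log_iff_exp_le hn0]
    have h3 : (3 : ℝ) ≤ n := by exact_mod_cast hn
    linarith [Real.exp_one_lt_d9]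
  have hshift : ∑ i ∈ Finset.Icc 1 n, (∫ t in (0:ℝ)..((i : ℝ) / (n : ℝ)), g t) ^ 2
      = ∑ k ∈ Finset.range n, (∫ t in (0:ℝ)..a (k + 1), g t) ^ 2 := by
    rw [Finset.range_eq_Ico, Finset.sum_Ico_add' (fun i => (∫ t in (0:ℝ)..a i, g t) ^ 2) 0 n 1]
    rfl
  rw [hshift] at hsum
  calc (∫ x in (0:ℝ)..1, (∫ t in (0:ℝ)..x, g t) ^ 2)
      = ∑ k ∈ Finset.range n, ∫ x in a k..a (k + 1), (∫ t in (0:ℝ)..x, g t) ^ 2 := hsumF.symm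
    _ ≤ ∑ k ∈ Finset.range n, (n : ℝ)⁻¹ * (2 * (∫ t in (0:ℝ)..a (k + 1), g t) ^ 2
          + 2 * ((n : ℝ)⁻¹ * ∫ t in a k..a (k + 1), g t ^ 2)) := by
        refine Finset.sum_le_sum fun k hk => ?_
        have hk := Finset.mem_range.1 hk
        have h := intervalIntegral_sq_primitive_le (hnn k) (hmono k.le_succ)
          (hg.mono_set (hsub0 k hk)) (hg2.mono_set (hsub0 k hk)) (hFi.mono_set (hsub k hk))
        simpa only [Nat.succ_eq_add_one, hstep] using h
    _ = 2 * ((n : ℝ)⁻¹ * ∑ k ∈ Finset.range n, (∫ t in (0:ℝ)..a (k + 1), g t) ^ 2)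
          + 2 * (∫ t in (0:ℝ)..1, g t ^ 2) / (n : ℝ) ^ 2 := by
        rw [← hsumG, ← Finset.mul_sum, Finset.sum_add_distrib, ← Finset.mul_sum,
          ← Finset.mul_sum, ← Finset.mul_sum]
        field_simp
    _ ≤ 2 * ε ^ 2 + 2 * Real.log n / (n : ℝ) ^ 2 := by
        gcongr
        linarith
end
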